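/- Let C be a Z2Z4-additive cyclic code and let D be a maximal cyclic subcode of C with linear binary image; that is, D is an additive subgroup with D ⊆ C, π(D) = D, Φ(D) is closed under addition, and every additive subgroup D' with D ⊆ D' ⊆ C, π(D') = D', and Φ(D') closed under addition satisfies D' = D. Then K(C) ⊆ D. -/

import Mathlib

open Polynomial

namespace Z2Z4

variable {α β : ℕ}

/-- The ambient space `ℤ₂^α × ℤ₄^β`. -/
abbrev V (α β : ℕ) := (Fin α → ZMod 2) × (Fin β → ZMod 4)

/-- The binary ambient space `ℤ₂^(α+2β)`, written as a product. -/
abbrev B (α β : ℕ) := (Fin α → ZMod 2) × ((Fin β → ZMod 2) × (Fin β → ZMod 2))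

/-- The double cyclic shift `π(u | u') = (u_{α-1},u_0,…,u_{α-2} | u'_{β-1},u'_0,…,u'_{β-2})`. -/
def shift (v : V α β) : V α β :=
  (fun i => v.1 ((finRotate α).symm i), fun i => v.2 ((finRotate β).symm i))

/-- For `z = t + 2h` with `t,h ∈ {0,1}`, this is `h`. -/
def grayHat (z : ZMod 4) : ZMod 2 := ((z.val / 2 : ℕ) : ZMod 2)

/-- For `z = t + 2h` with `t,h ∈ {0,1}`, this is `t`. -/
def grayTilde (z : ZMod 4) : ZMod 2 := ((z.val % 2 : ℕ) : ZMod 2)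

/-- The Gray map `φ(u') = (û', ũ' + û')`. -/
def phi (u : Fin β → ZMod 4) : (Fin β → ZMod 2) × (Fin β → ZMod 2) :=
  (fun i => grayHat (u i), fun i => grayTilde (u i) + grayHat (u i))

/-- The extended Gray map `Φ(u | u') = (u, φ(u'))`. -/
def Phi (v : V α β) : B α β := (v.1, phi v.2)

/-- `2v*w = (0 | 2(v' * w'))`, componentwise product on the quaternary part. -/
def twoStar (v w : V α β) : V α β := (0, fun i => 2 * v.2 i * w.2 i)

/-- The kernel `K(C) = {v ∈ C : 2v*w ∈ C for all w ∈ C}`. -/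
def K (C : Set (V α β)) : Set (V α β) :=
  {v ∈ C | ∀ w ∈ C, twoStar v w ∈ C}

/-- `R(C) = {v : Φ(v) ∈ ⟨Φ(C)⟩}`. -/
def R (C : Set (V α β)) : Set (V α β) :=
  {v | Phi v ∈ Submodule.span (ZMod 2) (Phi '' C)}

/-- The kernel of a quaternary code `D ⊆ ℤ₄^β`. -/
def KQ (D : Set (Fin β → ZMod 4)) : Set (Fin β → ZMod 4) :=
  {v ∈ D | ∀ w ∈ D, (fun i => 2 * v i * w i) ∈ D}

/-- `R(D) = {v' : φ(v') ∈ ⟨φ(D)⟩}` for a quaternary code `D ⊆ ℤ₄^β`. -/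
def RQ (D : Set (Fin β → ZMod 4)) : Set (Fin β → ZMod 4) :=
  {v | phi v ∈ Submodule.span (ZMod 2) (phi '' D)}

/-- The kernel of a binary code: `{x : x + D = D}`. -/
def kerSet {M : Type*} [AddCommGroup M] (D : Set M) : Set M :=
  {x | (fun d => x + d) '' D = D}

/-- The dimension of the kernel of a binary code. -/
noncomputable def dimKer {M : Type*} [AddCommGroup M] [Module (ZMod 2) M] (D : Set M) : ℕ :=
  Module.finrank (ZMod 2) (Submodule.span (ZMod 2) (kerSet D))

/-- The rank of a binary code: the dimension of its linear span. -/
noncomputable def rankOf {M : Type*} [AddCommGroup M] [Module (ZMod 2) M] (D : Set M) : ℕ :=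
  Module.finrank (ZMod 2) (Submodule.span (ZMod 2) D)

/-- `Φ(S)` is linear (closed under addition). -/
def grayAddClosed (S : Set (V α β)) : Prop :=
  ∀ x ∈ Phi '' S, ∀ y ∈ Phi '' S, x + y ∈ Phi '' S

/-- `φ(D)` is linear (closed under addition), for a quaternary code. -/
def grayAddClosedQ (D : Set (Fin β → ZMod 4)) : Prop :=
  ∀ x ∈ phi '' D, ∀ y ∈ phi '' D, x + y ∈ phi '' D

/-- The modulo-2 reduction `ℤ₄ → ℤ₂`. -/
def red2c : ZMod 4 →+* ZMod 2 := ZMod.castHom (show 2 ∣ 4 by norm_num) (ZMod 2)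

/-- The modulo-2 reduction of a polynomial over `ℤ₄`. -/
noncomputable def red2 : Polynomial (ZMod 4) →+* Polynomial (ZMod 2) := Polynomial.mapRingHom red2c

/-- Scalar multiplication of `c ∈ ℤ₄` on `ℤ₂^α × ℤ₄^β` (mod-2 reduction on the binary part). -/
def smul4 (c : ZMod 4) (v : V α β) : V α β := (red2c c • v.1, c • v.2)

/-- The action of a polynomial `p ∈ ℤ₄[x]`: `p ⋆ v = ∑ p_j • π^j(v)`, which is the
module action of `ℤ₄[x]` on `ℤ₂[x]/(x^α-1) × ℤ₄[x]/(x^β-1)` in vector form. -/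
noncomputable def polyAct (p : Polynomial (ZMod 4)) (v : V α β) : V α β :=
  ∑ j ∈ Finset.range (p.natDegree + 1), smul4 (p.coeff j) (shift^[j] v)

/-- The vector in `ℤ₂^α` corresponding to `p mod (x^α - 1)`. -/
noncomputable def toVec2 (p : Polynomial (ZMod 2)) : Fin α → ZMod 2 :=
  fun i => ∑ j ∈ Finset.range (p.natDegree + 1), if j % α = (i : ℕ) then p.coeff j else 0

/-- The vector in `ℤ₄^β` corresponding to `p mod (x^β - 1)`. -/
noncomputable def toVec4 (p : Polynomial (ZMod 4)) : Fin β → ZMod 4 :=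
  fun i => ∑ j ∈ Finset.range (p.natDegree + 1), if j % β = (i : ℕ) then p.coeff j else 0

/-- The `ℤ₄[x]`-submodule of `R_{α,β}` generated by `(b | 0)` and `(ℓ | a)`, in vector form. -/
def genCode (α β : ℕ) (b ℓ : Polynomial (ZMod 2)) (a : Polynomial (ZMod 4)) : Set (V α β) :=
  {x : V α β | ∃ p q : Polynomial (ZMod 4),
    x = polyAct p (toVec2 b, 0) + polyAct q (toVec2 ℓ, toVec4 a)}

/-- The `ℤ₂ℤ₄`-additive cyclic code `⟨(b | 0), (ℓ | fh + 2f)⟩`. -/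
def stdCode (α β : ℕ) (b ℓ : Polynomial (ZMod 2)) (f h : Polynomial (ZMod 4)) : Set (V α β) :=
  genCode α β b ℓ (f * h + 2 * f)

end Z2Z4

namespace Z2Z4

/-- The double cyclic shift as an additive homomorphism. -/
def shiftHom (α β : ℕ) : V α β →+ V α β where
  toFun := shift
  map_zero' := rfl
  map_add' _ _ := rfl

theorem shift_injective {α β : ℕ} : Function.Injective (shift : V α β → V α β) := by
  intro v w h
  obtain ⟨h₁, h₂⟩ := Prod.ext_iff.mp h
  refine Prod.ext (funext fun i => ?_) (funext fun i => ?_)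
  · simpa only [shift, Equiv.symm_apply_apply] using congrFun h₁ (finRotate α i)
  · simpa only [shift, Equiv.symm_apply_apply] using congrFun h₂ (finRotate β i)

theorem shift_image_eq_iff {α β : ℕ} (S : AddSubgroup (V α β)) :
    shift '' (S : Set (V α β)) = S ↔ S.map (shiftHom α β) = S := by
  rw [← SetLike.coe_set_eq (p := S.map _), AddSubgroup.coe_map]
  rfl

theorem twoStar_comm {α β : ℕ} (v w : V α β) : twoStar v w = twoStar w v :=
  Prod.ext rfl (funext fun _ => mul_right_comm _ _ _)

theorem twoStar_add_left {α β : ℕ} (u v w : V α β) :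
    twoStar (u + v) w = twoStar u w + twoStar v w := by
  ext i <;> simp [twoStar, mul_add, add_mul]

theorem twoStar_neg_left {α β : ℕ} (v w : V α β) : twoStar (-v) w = -twoStar v w := by
  ext i <;> simp [twoStar]

theorem twoStar_zero_left {α β : ℕ} (w : V α β) : twoStar 0 w = 0 := by
  ext i <;> simp [twoStar]

theorem twoStar_twoStar {α β : ℕ} (u v w : V α β) : twoStar (twoStar u v) w = 0 := by
  have h : ∀ a b c : ZMod 4, 2 * (2 * a * b) * c = 0 := by decide
  exact Prod.ext rfl (funext fun _ => h _ _ _)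

theorem Phi_injective {α β : ℕ} : Function.Injective (Phi : V α β → B α β) := by
  have h : ∀ a b : ZMod 4, grayHat a = grayHat b →
      grayTilde a + grayHat a = grayTilde b + grayHat b → a = b := by decide
  intro v w hvw
  simp only [Phi, phi, Prod.mk.injEq] at hvw
  exact Prod.ext hvw.1 (funext fun i => h _ _ (congrFun hvw.2.1 i) (congrFun hvw.2.2 i))

theorem Phi_add_Phi {α β : ℕ} (v w : V α β) : Phi v + Phi w = Phi (v + w + twoStar v w) := by
  have h₁ : ∀ a b : ZMod 4, grayHat a + grayHat b = grayHat (a + b + 2 * a * b) := by decide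
  have h₂ : ∀ a b : ZMod 4, (grayTilde a + grayHat a) + (grayTilde b + grayHat b) =
      grayTilde (a + b + 2 * a * b) + grayHat (a + b + 2 * a * b) := by decide
  exact Prod.ext (add_zero _).symm
    (Prod.ext (funext fun _ => h₁ _ _) (funext fun _ => h₂ _ _))

theorem grayAddClosed_iff {α β : ℕ} (S : AddSubgroup (V α β)) :
    grayAddClosed (S : Set (V α β)) ↔ ∀ v ∈ S, ∀ w ∈ S, twoStar v w ∈ S := by
  constructor
  · intro h v hv w hw
    obtain ⟨z, hz, hzeq⟩ := h _ ⟨v, hv, rfl⟩ _ ⟨w, hw, rfl⟩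
    rw [Phi_add_Phi] at hzeq
    rw [Phi_injective hzeq] at hz
    exact (S.add_mem_cancel_left (S.add_mem hv hw)).mp hz
  · rintro h _ ⟨v, hv, rfl⟩ _ ⟨w, hw, rfl⟩
    exact ⟨_, S.add_mem (S.add_mem hv hw) (h v hv w hw), (Phi_add_Phi v w).symm⟩

/-- The kernel of an additive code is an additive subgroup. -/
def kernelSubgroup {α β : ℕ} (C : AddSubgroup (V α β)) : AddSubgroup (V α β) where
  carrier := K (C : Set (V α β))
  zero_mem' := ⟨C.zero_mem, fun w _ => (twoStar_zero_left w).symm ▸ C.zero_mem⟩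
  add_mem' hu hv := ⟨C.add_mem hu.1 hv.1, fun w hw =>
    (twoStar_add_left _ _ w).symm ▸ C.add_mem (hu.2 w hw) (hv.2 w hw)⟩
  neg_mem' hv := ⟨C.neg_mem hv.1, fun w hw =>
    (twoStar_neg_left _ w).symm ▸ C.neg_mem (hv.2 w hw)⟩

theorem twoStar_mem_kernelSubgroup {α β : ℕ} {C : AddSubgroup (V α β)} {v w : V α β}
    (hv : v ∈ kernelSubgroup C) (hw : w ∈ C) : twoStar v w ∈ kernelSubgroup C :=
  ⟨hv.2 w hw, fun u _ => (twoStar_twoStar v w u).symm ▸ C.zero_mem⟩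

/-- The kernel of a cyclic code is cyclic. -/
theorem shift_image_K {α β : ℕ} {C : Set (V α β)} (hC : shift '' C = C) :
    shift '' K C = K C := by
  have mem_iff (v : V α β) : shift v ∈ C ↔ v ∈ C := by
    conv_lhs => rw [← hC]
    exact shift_injective.mem_set_image
  ext v
  constructor
  · rintro ⟨v, hv, rfl⟩
    refine ⟨(mem_iff v).mpr hv.1, fun w hw => ?_⟩
    obtain ⟨u, hu, rfl⟩ := hC.symm ▸ hw
    exact (mem_iff (twoStar v u)).mpr (hv.2 u hu)
  · rintro ⟨hv, hv'⟩
    obtain ⟨v, hvC, rfl⟩ := hC.symm ▸ hv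
    exact ⟨v, ⟨hvC, fun w hw => (mem_iff _).mp (hv' _ ((mem_iff w).mpr hw))⟩, rfl⟩

/-- If `D` is a maximal cyclic subcode of the `ℤ₂ℤ₄`-additive cyclic code
`C` with linear binary image, then `K(C) ⊆ D`. -/
theorem kernel_subset_maximal (α β : ℕ) (C D : AddSubgroup (V α β))
    (hcyc : shift '' (C : Set (V α β)) = (C : Set (V α β)))
    (hDC : (D : Set (V α β)) ⊆ (C : Set (V α β)))
    (hDcyc : shift '' (D : Set (V α β)) = (D : Set (V α β)))
    (hDlin : grayAddClosed (D : Set (V α β)))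
    (hmax : ∀ D' : AddSubgroup (V α β),
      (D : Set (V α β)) ⊆ (D' : Set (V α β)) →
      (D' : Set (V α β)) ⊆ (C : Set (V α β)) →
      shift '' (D' : Set (V α β)) = (D' : Set (V α β)) →
      grayAddClosed (D' : Set (V α β)) → D' = D) :
    K (C : Set (V α β)) ⊆ (D : Set (V α β)) := by
  have hKC : kernelSubgroup C ≤ C := fun _ hv => hv.1
  have hsup : D ⊔ kernelSubgroup C ≤ C := sup_le hDC hKC
  have hcyc' : shift '' ((D ⊔ kernelSubgroup C : AddSubgroup (V α β)) : Set (V α β)) =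
      (D ⊔ kernelSubgroup C : AddSubgroup (V α β)) := by
    rw [shift_image_eq_iff, AddSubgroup.map_sup, (shift_image_eq_iff D).mp hDcyc,
      (shift_image_eq_iff (kernelSubgroup C)).mp (shift_image_K hcyc)]
  have hlin : grayAddClosed ((D ⊔ kernelSubgroup C : AddSubgroup (V α β)) : Set (V α β)) := by
    rw [grayAddClosed_iff] at hDlin ⊢
    intro v hv w hw
    have hwC := hsup hw
    obtain ⟨d, hd, k, hk, rfl⟩ := AddSubgroup.mem_sup.mp hv
    obtain ⟨d', hd', k', hk', rfl⟩ := AddSubgroup.mem_sup.mp hw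
    rw [twoStar_add_left]
    refine add_mem ?_ (AddSubgroup.mem_sup_right (twoStar_mem_kernelSubgroup hk hwC))
    rw [twoStar_comm, twoStar_add_left]
    refine add_mem (AddSubgroup.mem_sup_left (hDlin d' hd' d hd)) ?_
    exact AddSubgroup.mem_sup_right (twoStar_mem_kernelSubgroup hk' (hDC hd))
  have hD : D ⊔ kernelSubgroup C = D := hmax _ (le_sup_left : D ≤ _) hsup hcyc' hlin
  have hle : kernelSubgroup C ≤ D := sup_eq_left.mp hD
  exact hle

end Z2Z4
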